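/- arXiv:2406.01910 — 2 statements merged into one kernel-verified Lean document; each statement's English description precedes it below -/
import Mathlib

section
/- For every finite simple connected undirected graph G = (V,E) on n ≥ 2 vertices and every valuation f : V → {1,…,n}, the expected convergence time of the asynchronous maximum model satisfies T(G,f) ≤ n². In particular the convergence time 𝒯(G) = max_f T(G,f) is O(n²). -/
open MeasureTheory
open scoped ENNReal

attribute [local instance] Classical.propDecidable

/-- The neighbours of `v` in `G`, as a finset. -/
noncomputable def nbrs {V : Type*} [Fintype V] (G : SimpleGraph V) (v : V) : Finset V :=
  Finset.univ.filter (fun u => G.Adj v u)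

/-- The asynchronous maximum update of a valuation `f` at the vertex `v`:
the value at `v` is replaced by the maximum of `f` over the neighbours of `v`
(if `v` has at least one neighbour; otherwise nothing changes), and all other
values are unchanged. -/
noncomputable def amUpdate {V : Type*} [Fintype V] (G : SimpleGraph V)
    (f : V → ℕ) (v : V) : V → ℕ :=
  fun u => if u = v ∧ (nbrs G v).Nonempty then (nbrs G v).sup f else f u

/-- The asynchronous maximum model: starting from the valuation `f`, at round `t` the vertex
`ω t` is chosen and updated. `amRun G f ω t` is the valuation after `t` rounds. -/
noncomputable def amRun {V : Type*} [Fintype V] (G : SimpleGraph V)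
    (f : V → ℕ) (ω : ℕ → V) : ℕ → V → ℕ
  | 0 => f
  | (t + 1) => amUpdate G (amRun G f ω t) (ω t)

/-- The convergence time along the update sequence `ω`: the least `t` such that the valuation
after `t` rounds is constant, and `∞` if no such `t` exists (as a value in `ℝ≥0∞`). -/
noncomputable def convTime {V : Type*} [Fintype V] (G : SimpleGraph V)
    (f : V → ℕ) (ω : ℕ → V) : ℝ≥0∞ :=
  ⨅ (t : ℕ) (_ : ∃ c : ℕ, amRun G f ω t = fun _ => c), (t : ℝ≥0∞)

/-- `μ` is the infinite product of uniform measures on `V`: a probability measure on `ℕ → V`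
under which the coordinates are independent and uniformly distributed on `V`, i.e. every
cylinder fixing the first `m` coordinates has measure `(1/|V|)^m`. -/
def IsUniformProduct {V : Type*} [Fintype V] [MeasurableSpace V]
    (μ : Measure (ℕ → V)) : Prop :=
  IsProbabilityMeasure μ ∧
    ∀ (m : ℕ) (g : ℕ → V),
      μ {ω | ∀ i < m, ω i = g i} = (1 / (Fintype.card V : ℝ≥0∞)) ^ m

section Core

variable {V : Type*} [Fintype V] (G : SimpleGraph V)

/-- The vertices of maximal value that have a neighbour of maximal value. -/
noncomputable def maxCore (f : V → ℕ) : Finset V :=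
  Finset.univ.filter fun v =>
    f v = Finset.univ.sup f ∧ ∃ u, G.Adj v u ∧ f u = Finset.univ.sup f

variable {G}

theorem mem_maxCore {f : V → ℕ} {v : V} :
    v ∈ maxCore G f ↔
      f v = Finset.univ.sup f ∧ ∃ u, G.Adj v u ∧ f u = Finset.univ.sup f := by
  simp [maxCore]

theorem amUpdate_of_ne (f : V → ℕ) {v u : V} (h : u ≠ v) : amUpdate G f v u = f u := by
  simp [amUpdate, h]

theorem amUpdate_self_of_adj {f : V → ℕ} {v u : V} (h : G.Adj v u)
    (hu : f u = Finset.univ.sup f) : amUpdate G f v v = Finset.univ.sup f := by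
  have hmem : u ∈ nbrs G v := by simp [nbrs, h]
  have hne : (nbrs G v).Nonempty := ⟨u, hmem⟩
  simp only [amUpdate, hne, and_self, if_true]
  exact le_antisymm (Finset.sup_mono (Finset.subset_univ _)) (hu ▸ Finset.le_sup hmem)

theorem sup_amUpdate_le (f : V → ℕ) (v : V) :
    Finset.univ.sup (amUpdate G f v) ≤ Finset.univ.sup f := by
  refine Finset.sup_le fun u _ => ?_
  unfold amUpdate
  split_ifs
  · exact Finset.sup_mono (Finset.subset_univ _)
  · exact Finset.le_sup (Finset.mem_univ u)

theorem mem_maxCore_amUpdate {f : V → ℕ} {v a b : V} (hab : G.Adj a b)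
    (ha : amUpdate G f v a = Finset.univ.sup f) (hb : amUpdate G f v b = Finset.univ.sup f) :
    a ∈ maxCore G (amUpdate G f v) := by
  have hsup : Finset.univ.sup (amUpdate G f v) = Finset.univ.sup f :=
    le_antisymm (sup_amUpdate_le f v) (ha ▸ Finset.le_sup (Finset.mem_univ a))
  exact mem_maxCore.2 ⟨by rw [ha, hsup], b, hab, by rw [hb, hsup]⟩

theorem amUpdate_of_mem_maxCore {f : V → ℕ} {x : V} (hx : x ∈ maxCore G f) (v : V) :
    amUpdate G f v x = Finset.univ.sup f := by
  obtain ⟨hxM, u, hxu, hu⟩ := mem_maxCore.1 hx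
  by_cases h : x = v
  · subst h
    exact amUpdate_self_of_adj hxu hu
  · rw [amUpdate_of_ne f h, hxM]

theorem maxCore_subset_amUpdate (f : V → ℕ) (v : V) :
    maxCore G f ⊆ maxCore G (amUpdate G f v) := by
  intro x hx
  obtain ⟨hxM, u, hxu, hu⟩ := mem_maxCore.1 hx
  have hu' : u ∈ maxCore G f := mem_maxCore.2 ⟨hu, x, hxu.symm, hxM⟩
  exact mem_maxCore_amUpdate hxu (amUpdate_of_mem_maxCore hx v) (amUpdate_of_mem_maxCore hu' v)

theorem exists_maxCore_ssubset_amUpdate (hG : G.Connected) {f : V → ℕ}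
    (hf : ¬ ∃ c : ℕ, f = fun _ => c) :
    ∃ v, maxCore G f ⊂ maxCore G (amUpdate G f v) := by
  have := hG.nonempty
  obtain ⟨m, -, hm⟩ := Finset.exists_mem_eq_sup Finset.univ Finset.univ_nonempty f
  let S : Set V := {x | x ∈ maxCore G f ∨ x = m}
  have hS : ∀ x ∈ S, f x = Finset.univ.sup f := by
    rintro x (hx | rfl)
    · exact (mem_maxCore.1 hx).1
    · exact hm.symm
  obtain ⟨y, hy⟩ : ∃ y, y ∉ S := by
    by_contra! h
    exact hf ⟨_, funext fun x => hS x (h x)⟩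
  obtain ⟨p⟩ := hG.preconnected m y
  obtain ⟨d, -, hd, hd'⟩ := p.exists_boundary_dart S (Or.inr rfl) hy
  refine ⟨d.snd, Finset.ssubset_iff_of_subset (maxCore_subset_amUpdate f _) |>.2
    ⟨d.snd, ?_, fun h => hd' (Or.inl h)⟩⟩
  refine mem_maxCore_amUpdate d.adj.symm (amUpdate_self_of_adj d.adj.symm (hS _ hd)) ?_
  rw [amUpdate_of_ne f d.adj.ne, hS _ hd]

/-- The drift inequality: summed over all vertices, the size of the complement of the core
drops by at least one as long as the valuation is not constant. -/
theorem sum_card_compl_maxCore_amUpdate_le (hG : G.Connected) (f : V → ℕ) :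
    (∑ v, (maxCore G (amUpdate G f v))ᶜ.card) + (if ∃ c : ℕ, f = fun _ => c then 0 else 1)
      ≤ Fintype.card V * (maxCore G f)ᶜ.card := by
  have hle : ∀ v ∈ Finset.univ,
      (maxCore G (amUpdate G f v))ᶜ.card ≤ (maxCore G f)ᶜ.card := fun v _ =>
    Finset.card_le_card (Finset.compl_subset_compl.2 (maxCore_subset_amUpdate f v))
  have hconst : ∑ _v : V, (maxCore G f)ᶜ.card = Fintype.card V * (maxCore G f)ᶜ.card := by
    simp
  rw [← hconst]
  split_ifs with hf
  · exact Finset.sum_le_sum hle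
  · obtain ⟨v, hv⟩ := exists_maxCore_ssubset_amUpdate hG hf
    exact Finset.sum_lt_sum hle
      ⟨v, Finset.mem_univ v, Finset.card_lt_card (Finset.compl_ssubset_compl.2 hv)⟩

end Core

section Run

variable {V : Type*} [Fintype V]

theorem amRun_congr (G : SimpleGraph V) (f : V → ℕ) {ω ω' : ℕ → V} {t : ℕ}
    (h : ∀ i < t, ω i = ω' i) : amRun G f ω t = amRun G f ω' t := by
  induction t with
  | zero => rfl
  | succ t ih =>
    simp only [amRun]
    rw [ih fun i hi => h i (by omega), h t (by omega)]

/-- The valuation reached after the updates listed in a finite word factors the run. -/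
theorem exists_amRun_eq_comp [Nonempty V] (G : SimpleGraph V) (f : V → ℕ) (t : ℕ) :
    ∃ R : (Fin t → V) → V → ℕ, ∀ ω : ℕ → V, amRun G f ω t = R fun i => ω i := by
  refine ⟨fun w => amRun G f
    (fun i => if h : i < t then w ⟨i, h⟩ else Classical.arbitrary V) t, fun ω => ?_⟩
  exact amRun_congr G f fun i hi => by simp [hi]

theorem convTime_le_tsum (G : SimpleGraph V) (f : V → ℕ) (ω : ℕ → V) :
    convTime G f ω ≤
      ∑' t : ℕ, if ∃ c : ℕ, amRun G f ω t = fun _ => c then (0 : ℝ≥0∞) else 1 := by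
  by_cases h : ∃ t : ℕ, ∃ c : ℕ, amRun G f ω t = fun _ => c
  · calc convTime G f ω ≤ (Nat.find h : ℝ≥0∞) := iInf₂_le (Nat.find h) (Nat.find_spec h)
      _ = ∑ t ∈ Finset.range (Nat.find h),
            if ∃ c : ℕ, amRun G f ω t = fun _ => c then (0 : ℝ≥0∞) else 1 := by
          rw [Finset.sum_congr rfl fun t ht => if_neg (Nat.find_min h (Finset.mem_range.1 ht))]
          simp
      _ ≤ _ := ENNReal.sum_le_tsum _
  · push Not at h
    simp [h]

variable [MeasurableSpace V] [MeasurableSingletonClass V]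

theorem measurable_comp_amRun [Nonempty V] (G : SimpleGraph V) (f : V → ℕ) (t : ℕ)
    (h : (V → ℕ) → ℝ≥0∞) : Measurable fun ω : ℕ → V => h (amRun G f ω t) := by
  obtain ⟨R, hR⟩ := exists_amRun_eq_comp G f t
  simp only [hR]
  have hm : Measurable fun w : Fin t → V => h (R w) := measurable_of_finite _
  exact hm.comp (measurable_pi_lambda _ fun i => measurable_pi_apply _)

variable {μ : Measure (ℕ → V)}

/-- The first `t + 1` coordinates are jointly uniform. -/
theorem IsUniformProduct.lintegral_init_prod [Nonempty V] (hμ : IsUniformProduct μ) (t : ℕ)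
    (F : (Fin t → V) → V → ℝ≥0∞) :
    ∫⁻ ω, F (fun i => ω i) (ω t) ∂μ
      = ∑ w, ∑ v, F w v * (1 / (Fintype.card V : ℝ≥0∞)) ^ (t + 1) := by
  have hJ : Measurable fun ω : ℕ → V => ((fun i : Fin t => ω i), ω t) := by fun_prop
  have hF : Measurable fun p : (Fin t → V) × V => F p.1 p.2 := measurable_of_finite _
  calc ∫⁻ ω, F (fun i => ω i) (ω t) ∂μ
      = ∫⁻ p, F p.1 p.2 ∂(μ.map fun ω : ℕ → V => ((fun i : Fin t => ω i), ω t)) :=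
        (lintegral_map hF hJ).symm
    _ = _ := by
      rw [lintegral_fintype, Fintype.sum_prod_type]
      refine Finset.sum_congr rfl fun w _ => Finset.sum_congr rfl fun v _ => ?_
      rw [Measure.map_apply hJ (measurableSet_singleton _),
        ← hμ.2 (t + 1) fun i => if h : i < t then w ⟨i, h⟩ else v]
      congr 2
      ext ω
      simp only [Set.mem_preimage, Set.mem_singleton_iff, Prod.mk.injEq, Set.mem_ofPred_eq,
        funext_iff]
      refine ⟨fun h i hi => ?_, fun h => ⟨fun i => ?_, ?_⟩⟩
      · split_ifs with hit
        · exact h.1 ⟨i, hit⟩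
        · obtain rfl : i = t := by omega
          exact h.2
      · simpa using h i (by omega)
      · simpa using h t (by omega)

/-- The Markov property of the asynchronous maximum model. -/
theorem IsUniformProduct.lintegral_amRun_succ [Nonempty V] (hμ : IsUniformProduct μ)
    (G : SimpleGraph V) (f : V → ℕ) (t : ℕ) (h : (V → ℕ) → ℝ≥0∞) :
    Fintype.card V * ∫⁻ ω, h (amRun G f ω (t + 1)) ∂μ
      = ∫⁻ ω, ∑ v, h (amUpdate G (amRun G f ω t) v) ∂μ := by
  obtain ⟨R, hR⟩ := exists_amRun_eq_comp G f t
  simp only [amRun, hR]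
  rw [hμ.lintegral_init_prod t fun w v => h (amUpdate G (R w) v),
    hμ.lintegral_init_prod t fun w _ => ∑ v, h (amUpdate G (R w) v), Finset.mul_sum]
  refine Finset.sum_congr rfl fun w _ => ?_
  rw [← Finset.sum_mul, Finset.sum_const, Finset.card_univ, nsmul_eq_mul]

theorem IsUniformProduct.sum_lintegral_add_le (hμ : IsUniformProduct μ) {G : SimpleGraph V}
    (hG : G.Connected) (f : V → ℕ) (m : ℕ) :
    (∑ t ∈ Finset.range m,
        ∫⁻ ω, (if ∃ c : ℕ, amRun G f ω t = fun _ => c then (0 : ℝ≥0∞) else 1) ∂μ)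
      + Fintype.card V * ∫⁻ ω, ((maxCore G (amRun G f ω m))ᶜ.card : ℝ≥0∞) ∂μ
      ≤ (Fintype.card V : ℝ≥0∞) ^ 2 := by
  have := hG.nonempty
  have := hμ.1
  induction m with
  | zero =>
    simp only [Finset.range_zero, Finset.sum_empty, zero_add, amRun, lintegral_const,
      measure_univ, mul_one, sq]
    gcongr
    exact Finset.card_le_univ _
  | succ m ih =>
    refine le_trans ?_ ih
    rw [Finset.sum_range_succ, add_assoc,
      hμ.lintegral_amRun_succ G f m fun g => ((maxCore G g)ᶜ.card : ℝ≥0∞),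
      ← lintegral_add_left
        (measurable_comp_amRun G f m fun g => if ∃ c : ℕ, g = fun _ => c then 0 else 1),
      ← lintegral_const_mul _
        (measurable_comp_amRun G f m fun g => ((maxCore G g)ᶜ.card : ℝ≥0∞))]
    gcongr with ω
    rw [add_comm]
    have := sum_card_compl_maxCore_amUpdate_le hG (amRun G f ω m)
    exact_mod_cast this

end Run

/-- for every finite simple connected undirected graph on `n ≥ 2` vertices and
every valuation `f : V → {1,…,n}`, the expected convergence time of the asynchronous maximum
model satisfies `T(G,f) ≤ n²`.  In particular `𝒯(G) = O(n²)`. -/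
theorem expected_convTime_le_sq {V : Type*} [Fintype V]
    [MeasurableSpace V] [MeasurableSingletonClass V] (n : ℕ) (hn2 : 2 ≤ n)
    (hn : Fintype.card V = n) (G : SimpleGraph V) (hG : G.Connected)
    (f : V → ℕ) (hf : ∀ v, f v ∈ Finset.Icc 1 n)
    (μ : Measure (ℕ → V)) (hμ : IsUniformProduct μ) :
    ∫⁻ ω, convTime G f ω ∂μ ≤ (n : ℝ≥0∞) ^ 2 := by
  have := hG.nonempty
  subst hn
  calc ∫⁻ ω, convTime G f ω ∂μ
      ≤ ∫⁻ ω, ∑' t : ℕ, (if ∃ c : ℕ, amRun G f ω t = fun _ => c then (0 : ℝ≥0∞) else 1) ∂μ :=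
        lintegral_mono fun ω => convTime_le_tsum G f ω
    _ = ∑' t : ℕ, ∫⁻ ω, (if ∃ c : ℕ, amRun G f ω t = fun _ => c then (0 : ℝ≥0∞) else 1) ∂μ :=
        lintegral_tsum fun t => (measurable_comp_amRun G f t
          fun g => if ∃ c : ℕ, g = fun _ => c then 0 else 1).aemeasurable
    _ ≤ _ := by
        rw [ENNReal.tsum_eq_iSup_nat]
        exact iSup_le fun m => le_self_add.trans (hμ.sum_lintegral_add_le hG f m)
end

section
/- There exists a constant C > 0 such that for every finite strongly connected directed graph G = (V,E) on n ≥ 2 vertices with orbit b = b(G), and every valuation f : V → {1,…,n}, the expected number of rounds of the asynchronous maximum model started from f until the current valuation contains a strong cycle is at most C·n·b². -/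
open MeasureTheory
open scoped ENNReal

attribute [local instance] Classical.propDecidable

/-- The out-neighbours of `v` in the directed graph with edge relation `E`, as a finset. -/
noncomputable def outNbrs {V : Type*} [Fintype V] (E : V → V → Prop) (v : V) : Finset V :=
  Finset.univ.filter (fun u => E v u)

/-- The asynchronous maximum update of a valuation `f` at the vertex `v` in a directed graph:
the value at `v` is replaced by the maximum of `f` over the out-neighbours of `v` (if `v` has
at least one out-neighbour; otherwise nothing changes), and all other values are unchanged. -/
noncomputable def dUpdate {V : Type*} [Fintype V] (E : V → V → Prop)
    (f : V → ℕ) (v : V) : V → ℕ :=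
  fun u => if u = v ∧ (outNbrs E v).Nonempty then (outNbrs E v).sup f else f u

/-- The asynchronous maximum model on a directed graph: starting from the valuation `f`, at
round `t` the vertex `ω t` is chosen and updated.  `dRun E f ω t` is the valuation after `t`
rounds. -/
noncomputable def dRun {V : Type*} [Fintype V] (E : V → V → Prop)
    (f : V → ℕ) (ω : ℕ → V) : ℕ → V → ℕ
  | 0 => f
  | (t + 1) => dUpdate E (dRun E f ω t) (ω t)

/-- `x` lies on a strong cycle of the valuation `f`: a directed cycle (a nonempty list of
distinct vertices `v :: l` with an edge between consecutive vertices and an edge from the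
last back to `v`) all of whose vertices carry the maximum value `M_f = max_v f v`. -/
def onStrongCycle {V : Type*} [Fintype V] (E : V → V → Prop) (f : V → ℕ) (x : V) : Prop :=
  ∃ (v : V) (l : List V), (v :: l).Nodup ∧ List.Chain E v (l ++ [v]) ∧
    (∀ u ∈ v :: l, f u = Finset.univ.sup f) ∧ x ∈ v :: l

/-- The strong cycle set `C_f`: all vertices `x` that either lie on a strong cycle, or admit a
directed walk, all of whose vertices carry the maximum value `M_f`, to a vertex of a strong
cycle. -/
def strongCycleSet {V : Type*} [Fintype V] (E : V → V → Prop) (f : V → ℕ) : Set V :=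
  {x | f x = Finset.univ.sup f ∧ ∃ w, onStrongCycle E f w ∧
    Relation.ReflTransGen (fun a b => E a b ∧ f b = Finset.univ.sup f) x w}

/-- The orbit `b(G)` of a directed graph: the maximum over all vertices `x` of the length of a
shortest directed cycle through `x` (a cycle being a nonempty list of distinct vertices
`v :: l` with consecutive edges and an edge from the last vertex back to `v`, of length
`l.length + 1`). -/
noncomputable def orbit {V : Type*} [Fintype V] (E : V → V → Prop) : ℕ :=
  Finset.univ.sup fun x =>
    sInf {k : ℕ | ∃ (v : V) (l : List V), (v :: l).Nodup ∧ List.Chain E v (l ++ [v]) ∧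
      x ∈ v :: l ∧ k = l.length + 1}

/-- The valuation `f` contains a strong cycle. -/
def hasStrongCycle {V : Type*} [Fintype V] (E : V → V → Prop) (f : V → ℕ) : Prop :=
  ∃ x, onStrongCycle E f x

/-- The number of rounds, along the update sequence `ω`, until the current valuation contains
a strong cycle (`∞` if this never happens), as a value in `ℝ≥0∞`. -/
noncomputable def strongCycleTime {V : Type*} [Fintype V] (E : V → V → Prop)
    (f : V → ℕ) (ω : ℕ → V) : ℝ≥0∞ :=
  ⨅ (t : ℕ) (_ : hasStrongCycle E (dRun E f ω t)), (t : ℝ≥0∞)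

/-- `d` traverses backwards, with period `L`, a directed cycle with `L` distinct vertices. -/
structure IsBackwardCycle {V : Type*} (E : V → V → Prop) (d : ℕ → V) (L : ℕ) : Prop where
  pos : 0 < L
  edge : ∀ i, E (d (i + 1)) (d i)
  periodic : ∀ i, d (i + L) = d i
  ne : ∀ i j, i < j → j < i + L → d i ≠ d j

section Cycles

variable {V : Type*} {E : V → V → Prop}

theorem exists_isBackwardCycle_of_list {v : V} {l : List V} (hnd : (v :: l).Nodup)
    (hch : List.IsChain E (v :: (l ++ [v]))) {x : V} (hx : x ∈ v :: l) :
    ∃ d a, IsBackwardCycle E d (l.length + 1) ∧ d a = x := by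
  set L := l.length + 1 with hL
  have hlt : ∀ i, i % L < (v :: l).length := fun i => Nat.mod_lt _ (Nat.succ_pos _)
  let c : ℕ → V := fun i => (v :: l)[i % L]'(hlt i)
  have hc : ∀ i j, i % L = j % L → c i = c j := fun i j h => by simp only [c, h]
  have hcinj : ∀ i j, c i = c j → i % L = j % L := fun i j h =>
    (List.Nodup.getElem_inj_iff hnd).1 h
  have hcE : ∀ i, E (c i) (c (i + 1)) := by
    intro i
    have hi : i % L < L := Nat.mod_lt _ (Nat.succ_pos _)
    have h := List.isChain_iff_getElem.1 hch (i % L) (by simp; omega)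
    have h1 : (v :: (l ++ [v]))[i % L]'(by simp; omega) = c i := by
      simp only [c, ← List.cons_append]
      exact List.getElem_append_left (hlt i)
    have h2 : (v :: (l ++ [v]))[i % L + 1]'(by simp; omega) = c (i + 1) := by
      rcases Nat.lt_or_ge (i % L + 1) L with h' | h'
      · have : (i + 1) % L = i % L + 1 := by
          rw [Nat.add_mod, Nat.mod_eq_of_lt (show 1 < L by omega), Nat.mod_eq_of_lt h']
        simp only [c, ← List.cons_append, this]
        exact List.getElem_append_left (by rw [List.length_cons]; exact h')
      · have h3 : i % L + 1 = L := by omega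
        have : (i + 1) % L = 0 := by
          rw [← Nat.mod_add_mod, h3, Nat.mod_self]
        have hlast : ∀ k (hk : k < (v :: (l ++ [v])).length), k = l.length + 1 →
            (v :: (l ++ [v]))[k] = v := by
          rintro k hk rfl
          simp
        have hfirst : ∀ k (hk : k < (v :: l).length), k = 0 → (v :: l)[k] = v := by
          rintro k hk rfl
          rfl
        exact (hlast _ _ h3).trans (hfirst _ _ this).symm
    rwa [h1, h2] at h
  have hstep : ∀ i, c ((L - 1) * i) = c ((L - 1) * (i + 1) + 1) := by
    intro i
    apply hc
    obtain ⟨k, hk⟩ : ∃ k, L = k + 1 := ⟨_, hL⟩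
    have : (L - 1) * (i + 1) + 1 = (L - 1) * i + L := by rw [hk]; simp; ring
    rw [this, Nat.add_mod_right]
  obtain ⟨k, hk, hkx⟩ := List.getElem_of_mem hx
  have hkL : k < L := by rw [List.length_cons] at hk; exact hk
  refine ⟨fun i => c ((L - 1) * i), L - k, ⟨Nat.succ_pos _, ?_, ?_, ?_⟩, ?_⟩
  · intro i
    rw [hstep i]
    exact hcE _
  · intro i
    apply hc
    rw [mul_add, Nat.add_mul_mod_self_right]
  · intro i j hij hji h
    have h1 : (L - 1) * i ≡ (L - 1) * j [MOD L] := hcinj _ _ h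
    have hcop : Nat.gcd L (L - 1) = 1 := by
      rw [hL]; simp
    have h2 : i ≡ j [MOD L] := Nat.ModEq.cancel_left_of_coprime hcop h1
    have h3 := (Nat.modEq_iff_dvd' hij.le).1 h2
    have := Nat.le_of_dvd (by omega) h3
    omega
  · change c _ = x
    rw [← hkx]
    have : ((L - 1) * (L - k)) % L = k := by
      obtain ⟨j, hj⟩ : ∃ j, L = k + j + 1 := ⟨L - k - 1, by omega⟩
      have : (L - 1) * (L - k) = k + L * j := by
        have h1 : L - 1 = k + j := by omega
        have h2 : L - k = j + 1 := by omega
        rw [h1, h2, hj]; ring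
      rw [this, Nat.add_mul_mod_self_left, Nat.mod_eq_of_lt hkL]
    simp only [c, this]

theorem exists_nodup_path_of_reflTransGen {u x : V} (h : Relation.ReflTransGen E u x) :
    ∃ q : List V, (q ++ [x]).Nodup ∧ List.IsChain E (q ++ [x]) ∧ (q ++ [x]).head? = some u := by
  induction h using Relation.ReflTransGen.head_induction_on with
  | refl => exact ⟨[], by simp⟩
  | @head a c hac _ ih =>
    obtain ⟨q, hnd, hch, hhd⟩ := ih
    by_cases ha : a ∈ q ++ [x]
    · rcases List.mem_append.1 ha with ha | ha
      · obtain ⟨s, t, rfl⟩ := List.append_of_mem ha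
        simp only [List.append_assoc] at hnd hch
        exact ⟨a :: t, hnd.of_append_right, hch.right_of_append, by simp⟩
      · obtain rfl := List.mem_singleton.1 ha
        exact ⟨[], by simp⟩
    · refine ⟨a :: q, List.nodup_cons.2 ⟨ha, hnd⟩, ?_, by simp⟩
      refine List.isChain_cons.2 ⟨?_, hch⟩
      intro y hy
      obtain rfl := Option.some.inj (hhd.symm.trans hy)
      exact hac

theorem exists_nodup_cycle [Nontrivial V] (hE : ∀ u v : V, Relation.ReflTransGen E u v) (x : V) :
    ∃ l : List V, (x :: l).Nodup ∧ List.IsChain E (x :: (l ++ [x])) := by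
  obtain ⟨z, hz⟩ := exists_ne x
  obtain ⟨y, hxy, -⟩ := (Relation.ReflTransGen.cases_head (hE x z)).resolve_left hz.symm
  obtain ⟨q, hnd, hch, hhd⟩ := exists_nodup_path_of_reflTransGen (hE y x)
  refine ⟨q, (List.perm_append_singleton x q).nodup_iff.1 hnd, List.isChain_cons.2 ⟨?_, hch⟩⟩
  intro u hu
  obtain rfl := Option.some.inj (hhd.symm.trans hu)
  exact hxy

theorem exists_isBackwardCycle_le_orbit [Fintype V] [Nontrivial V]
    (hE : ∀ u v : V, Relation.ReflTransGen E u v) (x : V) :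
    ∃ d a L, IsBackwardCycle E d L ∧ d a = x ∧ L ≤ orbit E := by
  obtain ⟨l₀, hnd₀, hch₀⟩ := exists_nodup_cycle hE x
  obtain ⟨v, l, hnd, hch, hx, hk⟩ := Nat.sInf_mem
    (s := {k : ℕ | ∃ (v : V) (l : List V), (v :: l).Nodup ∧ List.Chain E v (l ++ [v]) ∧
      x ∈ v :: l ∧ k = l.length + 1})
    ⟨_, x, l₀, hnd₀, hch₀, List.mem_cons_self, rfl⟩
  obtain ⟨d, a, hd, ha⟩ := exists_isBackwardCycle_of_list hnd hch hx
  refine ⟨d, a, _, hd, ha, ?_⟩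
  rw [← hk]
  exact Finset.le_sup (f := fun x => sInf {k : ℕ | ∃ (v : V) (l : List V), (v :: l).Nodup ∧
    List.Chain E v (l ++ [v]) ∧ x ∈ v :: l ∧ k = l.length + 1}) (Finset.mem_univ x)

theorem IsBackwardCycle.hasStrongCycle [Fintype V] {d : ℕ → V} {L : ℕ}
    (hd : IsBackwardCycle E d L) {f : V → ℕ} {a : ℕ}
    (h : ∀ i < L, f (d (a + i)) = Finset.univ.sup f) : hasStrongCycle E f := by
  obtain ⟨k, rfl⟩ : ∃ k, L = k + 1 := ⟨L - 1, by have := hd.pos; omega⟩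
  have hwrap : d (a + (k + 1)) = d a := hd.periodic a
  let l : List V := ((List.range k).map fun i => d (a + (i + 1))).reverse
  have hmem : ∀ u ∈ l, ∃ i < k, d (a + (i + 1)) = u := by
    intro u hu
    simpa [l] using hu
  have hchain : ∀ m, List.IsChain E
      (d (a + (m + 1)) :: ((((List.range m).map fun i => d (a + (i + 1))).reverse) ++ [d a])) := by
    intro m
    induction m with
    | zero => simpa using hd.edge a
    | succ m ih =>
      rw [List.range_succ, List.map_append, List.reverse_append]
      exact List.isChain_cons_cons.2 ⟨hd.edge _, ih⟩
  refine ⟨d a, d a, l, ?_, ?_, ?_, List.mem_cons_self⟩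
  · refine List.nodup_cons.2 ⟨?_, ?_⟩
    · intro hu
      obtain ⟨i, hi, hia⟩ := hmem _ hu
      exact hd.ne a (a + (i + 1)) (by omega) (by omega) hia.symm
    · rw [List.nodup_reverse]
      refine List.Nodup.map_on ?_ List.nodup_range
      intro i hi j hj hij
      rw [List.mem_range] at hi hj
      rcases lt_trichotomy i j with h' | h' | h'
      · exact absurd hij (hd.ne _ _ (by omega) (by omega))
      · exact h'
      · exact absurd hij.symm (hd.ne _ _ (by omega) (by omega))
  · have := hchain k
    rwa [hwrap] at this
  · intro u hu
    rcases List.mem_cons.1 hu with rfl | hu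
    · exact h 0 (by omega)
    · obtain ⟨i, hi, rfl⟩ := hmem _ hu
      exact h _ (by omega)

end Cycles

section ExtendSeq

variable {V : Type*}

/-- Extend a finite sequence of vertices to an infinite one. -/
noncomputable def extendSeq [Nonempty V] {t : ℕ} (g : Fin t → V) : ℕ → V :=
  fun i => if h : i < t then g ⟨i, h⟩ else Classical.arbitrary V

theorem extendSeq_cons_zero [Nonempty V] {t : ℕ} (v : V) (g : Fin t → V) :
    extendSeq (Fin.cons v g : Fin (t + 1) → V) 0 = v := by
  simp [extendSeq]

theorem extendSeq_cons_succ [Nonempty V] {t : ℕ} (v : V) (g : Fin t → V) (i : ℕ) :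
    extendSeq (Fin.cons v g : Fin (t + 1) → V) (i + 1) = extendSeq g i := by
  by_cases h : i < t
  · simp only [extendSeq, h, Nat.add_lt_add_iff_right, dif_pos]
    exact Fin.cons_succ (α := fun _ => V) v g ⟨i, h⟩
  · simp [extendSeq, h]

end ExtendSeq

section Update

variable {V : Type*} [Fintype V] {E : V → V → Prop}

theorem dUpdate_of_ne (f : V → ℕ) {u v : V} (h : u ≠ v) : dUpdate E f v u = f u := by
  simp [dUpdate, h]

theorem dUpdate_le_sup (f : V → ℕ) (v u : V) : dUpdate E f v u ≤ Finset.univ.sup f := by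
  unfold dUpdate
  split_ifs
  · exact Finset.sup_mono (Finset.subset_univ _)
  · exact Finset.le_sup (Finset.mem_univ u)

theorem dUpdate_self_of_edge {f : V → ℕ} {v w : V} (h : E v w) (hw : f w = Finset.univ.sup f) :
    dUpdate E f v v = Finset.univ.sup f := by
  have hmem : w ∈ outNbrs E v := by simpa [outNbrs] using h
  refine le_antisymm (dUpdate_le_sup f v v) ?_
  rw [dUpdate, if_pos ⟨rfl, w, hmem⟩, ← hw]
  exact Finset.le_sup hmem

theorem sup_dUpdate_eq {f : V → ℕ} {v u : V} (h : dUpdate E f v u = Finset.univ.sup f) :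
    Finset.univ.sup (dUpdate E f v) = Finset.univ.sup f :=
  le_antisymm (Finset.sup_le fun w _ => dUpdate_le_sup f v w)
    (h ▸ Finset.le_sup (Finset.mem_univ u))

theorem IsBackwardCycle.dUpdate_of_ne {d : ℕ → V} {L : ℕ} (hd : IsBackwardCycle E d L)
    {f : V → ℕ} {a m : ℕ} (h : ∀ i < m, f (d (a + i)) = Finset.univ.sup f) {v : V}
    (hv : v ≠ d a) {i : ℕ} (hi : i < m) :
    dUpdate E f v (d (a + i)) = Finset.univ.sup f := by
  by_cases hvi : d (a + i) = v
  · obtain _ | i := i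
    · exact absurd hvi.symm hv
    · subst hvi
      exact dUpdate_self_of_edge (hd.edge (a + i)) (h i (by omega))
  · rw [_root_.dUpdate_of_ne f hvi, h i hi]

/-- The expectation of the minimum of `N` and the number of rounds until a strong cycle. -/
noncomputable def truncatedTime (E : V → V → Prop) : ℕ → (V → ℕ) → ℝ
  | 0, _ => 0
  | N + 1, f => if hasStrongCycle E f then 0 else
      1 + (∑ v, truncatedTime E N (dUpdate E f v)) / Fintype.card V

theorem truncatedTime_of_hasStrongCycle {f : V → ℕ} (h : hasStrongCycle E f) (N : ℕ) :
    truncatedTime E N f = 0 := by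
  cases N <;> simp [truncatedTime, h]

theorem truncatedTime_le [Nontrivial V] (hE : ∀ u v : V, Relation.ReflTransGen E u v) (N : ℕ) :
    (∀ f : V → ℕ, truncatedTime E N f ≤ (Fintype.card V : ℝ) / 2 * (orbit E : ℝ) ^ 2) ∧
    ∀ (f : V → ℕ) (d : ℕ → V) (L a m : ℕ), IsBackwardCycle E d L → 1 ≤ m → m ≤ L →
      (∀ i < m, f (d (a + i)) = Finset.univ.sup f) →
      truncatedTime E N f ≤ (Fintype.card V : ℝ) / 2 * (m * (L - m)) +
        (1 - m / L) * ((Fintype.card V : ℝ) / 2 * (orbit E : ℝ) ^ 2) := by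
  set n : ℝ := (Fintype.card V : ℝ) with hn
  have hn0 : 0 < n := by rw [hn]; exact_mod_cast Fintype.card_pos
  set K : ℝ := n / 2 * (orbit E : ℝ) ^ 2 with hK
  have hK0 : 0 ≤ K := by positivity
  have hnonneg : ∀ {m L : ℕ}, 0 < L → m ≤ L →
      0 ≤ n / 2 * (m * (L - m) : ℝ) + (1 - m / L) * K := by
    intro m L hpos hmL
    have hL : (0 : ℝ) < L := by exact_mod_cast hpos
    have hmL' : (m : ℝ) ≤ L := by exact_mod_cast hmL
    have h1 : (m : ℝ) / L ≤ 1 := (div_le_one hL).2 hmL'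
    have h2 : 0 ≤ (1 - (m : ℝ) / L) * K := mul_nonneg (by linarith) hK0
    have h3 : 0 ≤ n / 2 * (m * (L - m) : ℝ) :=
      mul_nonneg (by positivity) (mul_nonneg (by positivity) (by linarith))
    exact add_nonneg h3 h2
  induction N with
  | zero =>
    exact ⟨fun f => hK0, fun f d L a m hd hm hmL _ => hnonneg hd.pos hmL⟩
  | succ N ih =>
    obtain ⟨ihK, ihm⟩ := ih
    have key : ∀ (f : V → ℕ) (d : ℕ → V) (L a m : ℕ), IsBackwardCycle E d L → 1 ≤ m → m ≤ L →
        (∀ i < m, f (d (a + i)) = Finset.univ.sup f) →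
        truncatedTime E (N + 1) f ≤ n / 2 * (m * (L - m)) + (1 - m / L) * K := by
      intro f d L a m hd hm hmL hf
      have hL : (0 : ℝ) < L := by exact_mod_cast hd.pos
      by_cases hs : hasStrongCycle E f
      · rw [truncatedTime_of_hasStrongCycle hs]
        exact hnonneg hd.pos hmL
      have hlt : m < L := by
        rcases hmL.lt_or_eq with h | rfl
        · exact h
        · exact absurd (hd.hasStrongCycle hf) hs
      let φ : ℝ → ℝ := fun r => n / 2 * (r * (L - r)) + (1 - r / L) * K
      have hother : ∀ v, v ≠ d a → truncatedTime E N (dUpdate E f v) ≤ φ m := by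
        intro v hv
        refine ihm _ d L a m hd hm hmL fun i hi => ?_
        have h := hd.dUpdate_of_ne hf hv hi
        rw [sup_dUpdate_eq h, h]
      have hne : d a ≠ d (a + m) := hd.ne a (a + m) (by omega) (by omega)
      have hgrow : truncatedTime E N (dUpdate E f (d (a + m))) ≤ φ (m + 1) := by
        have h : ∀ i < m + 1, dUpdate E f (d (a + m)) (d (a + i)) = Finset.univ.sup f := by
          intro i hi
          rcases Nat.lt_succ_iff_lt_or_eq.1 hi with hi | rfl
          · exact hd.dUpdate_of_ne hf hne.symm hi
          · obtain ⟨k, rfl⟩ : ∃ k, i = k + 1 := ⟨i - 1, by omega⟩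
            exact dUpdate_self_of_edge (hd.edge (a + k)) (hf k (by omega))
        have := ihm (dUpdate E f (d (a + m))) d L a (m + 1) hd (by omega) (by omega)
          fun i hi => by rw [sup_dUpdate_eq (h i hi), h i hi]
        simpa [φ] using this
      have hshrink : truncatedTime E N (dUpdate E f (d a)) ≤ φ (m - 1) := by
        obtain ⟨k, rfl⟩ : ∃ k, m = k + 1 := ⟨m - 1, by omega⟩
        rcases Nat.eq_zero_or_pos k with rfl | hk
        · simpa [φ] using ihK (dUpdate E f (d a))
        · have h : ∀ i < k, dUpdate E f (d a) (d (a + 1 + i)) = Finset.univ.sup f := by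
            intro i hi
            rw [dUpdate_of_ne f (hd.ne a (a + 1 + i) (by omega) (by omega)).symm]
            rw [show a + 1 + i = a + (i + 1) by ring]
            exact hf _ (by omega)
          have := ihm (dUpdate E f (d a)) d L (a + 1) k hd hk (by omega)
            fun i hi => by rw [sup_dUpdate_eq (h i hi), h i hi]
          simpa [φ] using this
      have hsum : ∑ v, truncatedTime E N (dUpdate E f v) ≤
          n * φ m + (φ (m + 1) - φ m) + (φ (m - 1) - φ m) := by
        calc ∑ v, truncatedTime E N (dUpdate E f v)
            ≤ ∑ v, (φ m + (if v = d (a + m) then φ (m + 1) - φ m else 0) +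
                (if v = d a then φ (m - 1) - φ m else 0)) := by
              refine Finset.sum_le_sum fun v _ => ?_
              by_cases h1 : v = d a
              · rw [if_neg (h1 ▸ hne), if_pos h1, h1]
                linarith
              · by_cases h2 : v = d (a + m)
                · rw [if_neg h1, if_pos h2, h2]
                  linarith
                · rw [if_neg h1, if_neg h2]
                  linarith [hother v h1]
          _ = _ := by
              simp [Finset.sum_add_distrib, hn]
      have hharm : n * φ m + (φ (m + 1) - φ m) + (φ (m - 1) - φ m) = n * (φ m - 1) := by
        simp only [φ]
        field_simp
        ring
      rw [truncatedTime, if_neg hs]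
      have : (∑ v, truncatedTime E N (dUpdate E f v)) / n ≤ φ m - 1 := by
        rw [div_le_iff₀ hn0, mul_comm]
        exact hharm ▸ hsum
      change 1 + _ / n ≤ φ m
      linarith
    refine ⟨fun f => ?_, key⟩
    obtain ⟨x, -, hx⟩ := Finset.exists_mem_eq_sup Finset.univ Finset.univ_nonempty f
    obtain ⟨d, a, L, hd, rfl, hL⟩ := exists_isBackwardCycle_le_orbit hE x
    have hLpos : (1 : ℝ) ≤ L := by exact_mod_cast hd.pos
    have hLb : (L : ℝ) ≤ orbit E := by exact_mod_cast hL
    refine (key f d L a 1 hd le_rfl hd.pos fun i hi => ?_).trans ?_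
    · rw [Nat.lt_one_iff.1 hi]
      exact hx.symm
    · have h1 : n / 2 * ((1 : ℕ) * (L - (1 : ℕ))) ≤ K / L := by
        rw [le_div_iff₀ (by linarith), hK]
        have : ((L : ℝ) - 1) * L ≤ (orbit E : ℝ) ^ 2 := by nlinarith
        have := mul_le_mul_of_nonneg_left this (show 0 ≤ n / 2 by positivity)
        push_cast
        linarith
      have h2 : (1 - ((1 : ℕ) : ℝ) / L) * K = K - K / L := by push_cast; ring
      linarith

theorem dRun_succ_eq (f : V → ℕ) (ω : ℕ → V) (t : ℕ) :
    dRun E f ω (t + 1) = dRun E (dUpdate E f (ω 0)) (fun i => ω (i + 1)) t := by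
  induction t with
  | zero => rfl
  | succ t ih => rw [dRun, ih, dRun]

theorem dRun_congr (f : V → ℕ) {ω ω' : ℕ → V} {t : ℕ} (h : ∀ i < t, ω i = ω' i) :
    dRun E f ω t = dRun E f ω' t := by
  induction t with
  | zero => rfl
  | succ t ih => rw [dRun, dRun, ih fun i hi => h i (by omega), h t (by omega)]

/-- No strong cycle appears during the first `t` rounds. -/
def Survives (E : V → V → Prop) (f : V → ℕ) (ω : ℕ → V) (t : ℕ) : Prop :=
  ∀ s ≤ t, ¬ hasStrongCycle E (dRun E f ω s)

theorem survives_congr (f : V → ℕ) {ω ω' : ℕ → V} {t : ℕ} (h : ∀ i < t, ω i = ω' i) :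
    Survives E f ω t ↔ Survives E f ω' t :=
  forall₂_congr fun s hs => by rw [dRun_congr f fun i hi => h i (by omega)]

theorem survives_succ_iff (f : V → ℕ) (ω : ℕ → V) (t : ℕ) :
    Survives E f ω (t + 1) ↔ ¬ hasStrongCycle E f ∧
      Survives E (dUpdate E f (ω 0)) (fun i => ω (i + 1)) t := by
  constructor
  · intro h
    exact ⟨h 0 (by omega), fun s hs => dRun_succ_eq (E := E) f ω s ▸ h (s + 1) (by omega)⟩
  · rintro ⟨h0, h⟩ (_ | s) hs
    · exact h0
    · rw [dRun_succ_eq]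
      exact h s (by omega)

/-- The number of update sequences of length `t` along which no strong cycle appears. -/
noncomputable def survivorCount [Nonempty V] (E : V → V → Prop) (f : V → ℕ) (t : ℕ) : ℕ :=
  ∑ g : Fin t → V, if Survives E f (extendSeq g) t then 1 else 0

theorem survivorCount_zero [Nonempty V] (f : V → ℕ) :
    survivorCount E f 0 = if hasStrongCycle E f then 0 else 1 := by
  simp [survivorCount, Survives, dRun]

theorem survivorCount_succ [Nonempty V] (f : V → ℕ) (t : ℕ) :
    survivorCount E f (t + 1) =
      if hasStrongCycle E f then 0 else ∑ v, survivorCount E (dUpdate E f v) t := by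
  rw [survivorCount, ← (Fin.consEquiv fun _ : Fin (t + 1) => V).sum_comp, Fintype.sum_prod_type]
  have hcons : ∀ (v : V) (g : Fin t → V),
      Fin.consEquiv (fun _ : Fin (t + 1) => V) (v, g) = Fin.cons v g := fun _ _ => rfl
  simp only [hcons, survives_succ_iff, extendSeq_cons_zero, extendSeq_cons_succ]
  split_ifs with h <;> simp [h, survivorCount]

theorem sum_survivorCount [Nonempty V] (f : V → ℕ) (N : ℕ) :
    ∑ t ∈ Finset.range N, (survivorCount E f t : ℝ) * (1 / (Fintype.card V : ℝ)) ^ t =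
      truncatedTime E N f := by
  induction N generalizing f with
  | zero => simp [truncatedTime]
  | succ N ih =>
    rw [Finset.sum_range_succ', truncatedTime, survivorCount_zero]
    split_ifs with h
    · simp [survivorCount_succ, h]
    · simp only [survivorCount_succ, if_neg h, ← ih]
      rw [Finset.sum_comm, Finset.sum_div, add_comm]
      push_cast
      congr 1
      · simp
      · refine Finset.sum_congr rfl fun t _ => ?_
        rw [Finset.sum_mul, Finset.sum_div]
        refine Finset.sum_congr rfl fun v _ => ?_
        rw [pow_succ]
        ring

theorem strongCycleTime_le_tsum [Nonempty V] (f : V → ℕ) (ω : ℕ → V) :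
    strongCycleTime E f ω ≤ ∑' t : ℕ, ∑ g : Fin t → V,
      (if Survives E f (extendSeq g) t then
        {ω : ℕ → V | ∀ i < t, ω i = extendSeq g i}.indicator 1 ω else 0) := by
  have hone : ∀ t, Survives E f ω t → (1 : ℝ≥0∞) ≤ ∑ g : Fin t → V,
      (if Survives E f (extendSeq g) t then
        {ω : ℕ → V | ∀ i < t, ω i = extendSeq g i}.indicator 1 ω else 0) := by
    intro t ht
    let g : Fin t → V := fun i => ω i
    have hg : ∀ i < t, ω i = extendSeq g i := fun i hi => by simp [extendSeq, hi, g]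
    refine le_trans ?_ (Finset.single_le_sum (fun _ _ => zero_le) (Finset.mem_univ g))
    rw [if_pos ((survives_congr f hg).1 ht), Set.indicator_of_mem (by exact hg)]
    exact le_rfl
  by_cases hex : ∃ t, hasStrongCycle E (dRun E f ω t)
  · have hsurv : ∀ t < Nat.find hex, Survives E f ω t :=
      fun t ht s hs => Nat.find_min hex (hs.trans_lt ht)
    calc
      strongCycleTime E f ω ≤ (Nat.find hex : ℝ≥0∞) := iInf₂_le
        (f := fun (t : ℕ) (_ : hasStrongCycle E (dRun E f ω t)) => (t : ℝ≥0∞)) _ (Nat.find_spec hex)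
      _ = ∑ t ∈ Finset.range (Nat.find hex), 1 := by simp
      _ ≤ _ := (Finset.sum_le_sum fun t ht => hone t (hsurv t (Finset.mem_range.1 ht))).trans
        (ENNReal.sum_le_tsum _)
  · have htop : (∑' _ : ℕ, (1 : ℝ≥0∞)) = ⊤ := ENNReal.tsum_const_eq_top_of_ne_zero one_ne_zero
    refine le_top.trans (htop ▸ ENNReal.tsum_le_tsum fun t => hone t ?_)
    exact fun s _ h => hex ⟨s, h⟩

theorem lintegral_strongCycleTime_le [Nonempty V] [MeasurableSpace V] [MeasurableSingletonClass V]
    (f : V → ℕ) {μ : Measure (ℕ → V)} (hμ : IsUniformProduct μ) :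
    ∫⁻ ω, strongCycleTime E f ω ∂μ ≤
      ∑' t : ℕ, (survivorCount E f t : ℝ≥0∞) * (1 / (Fintype.card V : ℝ≥0∞)) ^ t := by
  have hcyl : ∀ (t : ℕ) (g : ℕ → V), MeasurableSet {ω : ℕ → V | ∀ i < t, ω i = g i} := by
    intro t g
    simp only [Set.ofPred_forall]
    exact MeasurableSet.iInter fun i => MeasurableSet.iInter fun _ =>
      measurable_pi_apply (X := fun _ : ℕ => V) i (measurableSet_singleton (g i))
  have hmeas : ∀ (t : ℕ) (g : Fin t → V), Measurable fun ω : ℕ → V =>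
      (if Survives E f (extendSeq g) t then
        {ω : ℕ → V | ∀ i < t, ω i = extendSeq g i}.indicator (1 : (ℕ → V) → ℝ≥0∞) ω else 0) := by
    intro t g
    split_ifs
    · exact measurable_one.indicator (hcyl t _)
    · exact measurable_const
  refine (lintegral_mono fun ω => strongCycleTime_le_tsum f ω).trans ?_
  rw [lintegral_tsum fun t => (Finset.measurable_sum _ fun g _ => hmeas t g).aemeasurable]
  refine ENNReal.tsum_le_tsum fun t => ?_
  rw [lintegral_finsetSum _ fun g _ => hmeas t g, survivorCount, Nat.cast_sum, Finset.sum_mul]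
  refine Finset.sum_le_sum fun g _ => ?_
  split_ifs
  · rw [lintegral_indicator_one (hcyl t _), hμ.2, Nat.cast_one, one_mul]
  · simp

end Update

/-- there is a constant `C > 0` such that for every finite strongly connected
directed graph on `n ≥ 2` vertices with orbit `b` and every valuation `f : V → {1,…,n}`, the
expected number of rounds of the asynchronous maximum model started from `f` until the current
valuation contains a strong cycle is at most `C·n·b²`. -/
theorem expected_strongCycleTime_le :
    ∃ C : ℝ, 0 < C ∧
      ∀ (V : Type) [Fintype V] [MeasurableSpace V] [MeasurableSingletonClass V]
        (E : V → V → Prop) (n : ℕ), 2 ≤ n → Fintype.card V = n →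
        (∀ u v : V, Relation.ReflTransGen E u v) →
        ∀ (f : V → ℕ), (∀ v, f v ∈ Finset.Icc 1 n) →
        ∀ (μ : Measure (ℕ → V)), IsUniformProduct μ →
          ∫⁻ ω, strongCycleTime E f ω ∂μ ≤
            ENNReal.ofReal (C * (n : ℝ) * (orbit E : ℝ) ^ 2) := by
  refine ⟨1 / 2, by norm_num, ?_⟩
  intro V _ _ _ E n hn hcard hE f _ μ hμ
  have : Nontrivial V := Fintype.one_lt_card_iff_nontrivial.1 (by omega)
  refine (lintegral_strongCycleTime_le f hμ).trans (ENNReal.tsum_le_of_sum_range_le fun N => ?_)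
  have hterm : ∀ t, (survivorCount E f t : ℝ≥0∞) * (1 / (Fintype.card V : ℝ≥0∞)) ^ t =
      ENNReal.ofReal ((survivorCount E f t : ℝ) * (1 / (Fintype.card V : ℝ)) ^ t) := by
    intro t
    have hpos : (0 : ℝ) < Fintype.card V := by exact_mod_cast Fintype.card_pos
    rw [ENNReal.ofReal_mul (by positivity), ENNReal.ofReal_pow (by positivity),
      ENNReal.ofReal_div_of_pos hpos, ENNReal.ofReal_natCast, ENNReal.ofReal_natCast,
      ENNReal.ofReal_one]
  simp only [hterm]
  rw [← ENNReal.ofReal_sum_of_nonneg fun t _ => by positivity, sum_survivorCount]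
  refine ENNReal.ofReal_le_ofReal (((truncatedTime_le hE N).1 f).trans_eq ?_)
  rw [hcard]
  ring
end
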